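/- Let G be a finite simple graph on at least 3 vertices and t a positive integer such that for every partition P of V(G), |cr(P,G)| ≥ t(|P| - 1). Suppose G is edge-colored with exactly max_{P: |P|≥3}{ |E(P,G)| + t(|P|-2) } + 1 colors and contains no t pairwise edge-disjoint rainbow spanning trees. Then there exists an edge e of G whose color appears on at least two edges of G, such that after deleting e, every partition P of V(G) still satisfies |cr(P, G \ e)| ≥ t(|P| - 1). -/

import Mathlib

open Finset
open scoped Classical

/-- The set of non-crossing edges of `G` with respect to a partition `P` of the
vertex set: edges whose two endpoints lie in the same part of `P`. -/
noncomputable def edgesNonCrossing {V : Type} [Fintype V] (G : SimpleGraph V)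
    (P : Finpartition (Finset.univ : Finset V)) : Finset (Sym2 V) :=
  G.edgeFinset.filter (fun e => ∃ p ∈ P.parts, ∀ v ∈ e, v ∈ p)

/-- The set of crossing edges of `G` with respect to a partition `P` of the
vertex set: edges whose endpoints lie in different parts of `P`. -/
noncomputable def edgesCrossing {V : Type} [Fintype V] (G : SimpleGraph V)
    (P : Finpartition (Finset.univ : Finset V)) : Finset (Sym2 V) :=
  G.edgeFinset.filter (fun e => ¬ ∃ p ∈ P.parts, ∀ v ∈ e, v ∈ p)

/-- `G`, edge-colored by `c`, contains `t` pairwise edge-disjoint rainbow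
spanning trees. -/
def HasRainbowSpanningTrees {V : Type} [Fintype V] (G : SimpleGraph V)
    (c : Sym2 V → ℕ) (t : ℕ) : Prop :=
  ∃ T : Fin t → SimpleGraph V,
    (∀ i, T i ≤ G) ∧ (∀ i, (T i).IsTree) ∧
    (∀ i, Set.InjOn c ((T i).edgeSet)) ∧
    (∀ i j, i ≠ j → Disjoint ((T i).edgeSet) ((T j).edgeSet))

/-- The anti-Ramsey number `r(G,t)`: the maximum number of colors in an
edge-coloring of `G` containing no `t` pairwise edge-disjoint rainbow spanning
trees. -/
noncomputable def antiRamsey {V : Type} [Fintype V] (G : SimpleGraph V) (t : ℕ) : ℕ :=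
  sSup {m | ∃ c : Sym2 V → ℕ, (G.edgeFinset.image c).card = m ∧
    ¬ HasRainbowSpanningTrees G c t}

/-- `max_{P : |P| ≥ 3} { |E(P,G)| + t(|P|-2) }`. -/
noncomputable def maxNonCross3 {V : Type} [Fintype V] (G : SimpleGraph V) (t : ℕ) : ℕ :=
  sSup {m | ∃ P : Finpartition (Finset.univ : Finset V), 3 ≤ P.parts.card ∧
    m = (edgesNonCrossing G P).card + t * (P.parts.card - 2)}

/-- `f_G(s)`: the maximum of `|E(P,G)|` over partitions of the vertex set into
exactly `s` parts. -/
noncomputable def fMax {V : Type} [Fintype V] (G : SimpleGraph V) (s : ℕ) : ℕ :=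
  sSup {m | ∃ P : Finpartition (Finset.univ : Finset V), P.parts.card = s ∧
    m = (edgesNonCrossing G P).card}

/-- The number of edges of `G` induced by a set `p` of vertices. -/
noncomputable def edgesWithin {V : Type} [Fintype V] (G : SimpleGraph V) (p : Finset V) : ℕ :=
  (G.edgeFinset.filter (fun e => ∀ v ∈ e, v ∈ p)).card

/-- One splitting step: remove a single vertex from a currently largest part
(measured by the number of non-crossing edges it induces) to form a new
singleton part. -/
def SplitStep {V : Type} [Fintype V] (G : SimpleGraph V)
    (P Q : Finpartition (Finset.univ : Finset V)) : Prop :=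
  ∃ p ∈ P.parts, (∀ q ∈ P.parts, edgesWithin G q ≤ edgesWithin G p) ∧
    ∃ v ∈ p, p.erase v ≠ ∅ ∧
      Q.parts = insert {v} (insert (p.erase v) (P.parts.erase p))


namespace RST

variable {V : Type}

lemma edgeSet_edge_ne {u v : V} (h : u ≠ v) :
    (SimpleGraph.edge u v).edgeSet = {s(u, v)} := by
  rw [SimpleGraph.edgeSet_edge, sdiff_eq_left, Set.disjoint_singleton_left]
  simpa using h

/-- Remove the edge `f` from `A` and add the edge `uv`. -/
def swapG (A : SimpleGraph V) (f : Sym2 V) (u v : V) : SimpleGraph V :=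
  A.deleteEdges {f} ⊔ SimpleGraph.edge u v

lemma edgeSet_swapG (A : SimpleGraph V) (f : Sym2 V) {u v : V} (h : u ≠ v) :
    (swapG A f u v).edgeSet = insert s(u, v) (A.edgeSet \ {f}) := by
  rw [swapG, SimpleGraph.edgeSet_sup, SimpleGraph.edgeSet_deleteEdges,
    edgeSet_edge_ne h, Set.union_singleton]

lemma acyclic_swapG {A : SimpleGraph V} (hA : A.IsAcyclic) {f : Sym2 V} {u v : V}
    (hr : ¬ (A.deleteEdges {f}).Reachable u v) : (swapG A f u v).IsAcyclic :=
  (hA.anti (A.deleteEdges_le _)).sup_edge_of_not_reachable hr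

lemma ncard_swapG [Finite V] {A : SimpleGraph V} {f : Sym2 V} {u v : V} (h : u ≠ v)
    (hf : f ∈ A.edgeSet) (huv : s(u, v) ∉ A.edgeSet) :
    (swapG A f u v).edgeSet.ncard = A.edgeSet.ncard := by
  rw [edgeSet_swapG _ _ h, Set.ncard_insert_of_notMem (fun h => huv h.1),
    Set.ncard_sdiff_singleton_add_one hf]

lemma not_reach_of_mem_path {A : SimpleGraph V} (hA : A.IsAcyclic) {u v : V} {p : A.Walk u v}
    (hp : p.IsPath) {f : Sym2 V} (hf : f ∈ p.edges) :
    ¬ (A.deleteEdges {f}).Reachable u v := by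
  rintro ⟨q⟩
  have hle := A.deleteEdges_le {f}
  have h1 := hA.subsingleton_path u v |>.elim ⟨p, hp⟩
    ⟨q.toPath.1.mapLe hle, q.toPath.2.mapLe hle⟩
  have h2 : p = q.toPath.1.mapLe hle := congrArg Subtype.val h1
  rw [h2, SimpleGraph.Walk.edges_mapLe_eq_edges] at hf
  have := SimpleGraph.Walk.edges_subset_edgeSet _ hf
  rw [SimpleGraph.edgeSet_deleteEdges] at this
  exact this.2 rfl

lemma acyclic_card [Fintype V] [Nonempty V] {A : SimpleGraph V} (hA : A.IsAcyclic) :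
    A.edgeSet.ncard + 1 ≤ Fintype.card V ∧
      (A.edgeSet.ncard + 1 = Fintype.card V → A.IsTree) := by
  obtain ⟨T, hT, -, hTt⟩ : ∃ T, A ≤ T ∧ T ≤ ⊤ ∧ T.IsTree := by
    obtain ⟨T, h1, h2, h3⟩ := SimpleGraph.Connected.exists_isTree_le_of_le_of_isAcyclic
      (SimpleGraph.connected_top (V := V)) (le_top (a := A)) hA
    exact ⟨T, by assumption, by assumption, by assumption⟩
  have hc := (SimpleGraph.isTree_iff_connected_and_card.1 hTt).2
  rw [Nat.card_eq_fintype_card (α := V), Nat.card_coe_set_eq] at hc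
  have hsub : A.edgeSet ⊆ T.edgeSet := SimpleGraph.edgeSet_mono hT
  have hle := Set.ncard_le_ncard hsub (Set.toFinite _)
  refine ⟨by omega, fun h => ?_⟩
  have := Set.eq_of_subset_of_ncard_le hsub (by omega) (Set.toFinite _)
  rw [SimpleGraph.edgeSet_inj.1 this]
  exact hTt

lemma tree_card [Fintype V] {A : SimpleGraph V} (hA : A.IsTree) :
    A.edgeSet.ncard + 1 = Fintype.card V := by
  have hc := (SimpleGraph.isTree_iff_connected_and_card.1 hA).2
  rwa [Nat.card_eq_fintype_card (α := V), Nat.card_coe_set_eq] at hc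

lemma card_le_edges_add [Fintype V] [Nonempty V] {β : Type} [DecidableEq β] (H : SimpleGraph V) (φ : V → β)
    (h : ∀ u v, φ u = φ v → H.Reachable u v) :
    Fintype.card V ≤ H.edgeSet.ncard + (Finset.univ.image φ).card := by
  obtain ⟨r⟩ := ‹Nonempty V›
  let B := (Finset.univ.image φ).erase (φ r)
  let X : Finset (Sym2 V) := B.image (fun b => s(r, Function.invFun φ b))
  let H' := H ⊔ SimpleGraph.fromEdgeSet (X : Set (Sym2 V))
  have hinv : ∀ v, φ (Function.invFun φ (φ v)) = φ v := fun v =>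
    Function.invFun_eq ⟨v, rfl⟩
  have hconn : ∀ v, H'.Reachable r v := by
    intro v
    by_cases hv : φ v = φ r
    · exact (h r v hv.symm).mono le_sup_left
    · have h1 : H'.Adj r (Function.invFun φ (φ v)) := by
        refine Or.inr ?_
        rw [SimpleGraph.fromEdgeSet_adj]
        refine ⟨?_, ?_⟩
        · simp only [X, Finset.mem_coe, Finset.mem_image]
          exact ⟨φ v, by simp [B, hv], rfl⟩
        · intro he
          apply hv
          rw [← hinv v, ← he]
      exact h1.reachable.trans ((h _ v (hinv v)).mono le_sup_left)
  have hC : H'.Connected :=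
    { preconnected := fun u v => (hconn u).symm.trans (hconn v), nonempty := ⟨r⟩ }
  have h1 := hC.card_vert_le_card_edgeSet_add_one
  rw [Nat.card_eq_fintype_card (α := V), Nat.card_coe_set_eq] at h1
  have h2 : H'.edgeSet ⊆ H.edgeSet ∪ X := by
    rw [SimpleGraph.edgeSet_sup, SimpleGraph.edgeSet_fromEdgeSet]
    exact Set.union_subset_union_right _ Set.sdiff_subset
  have h3 := (Set.ncard_le_ncard h2 (Set.toFinite _)).trans (Set.ncard_union_le _ _)
  rw [Set.ncard_coe_finset] at h3
  have h4 : X.card ≤ B.card := Finset.card_image_le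
  have h5 : B.card + 1 = (Finset.univ.image φ).card :=
    Finset.card_erase_add_one (by simp)
  omega

/-- A family of pairwise edge-disjoint forests in `G`. -/
def Pack (G : SimpleGraph V) {t : ℕ} (F : Fin t → SimpleGraph V) : Prop :=
  (∀ i, F i ≤ G) ∧ (∀ i, (F i).IsAcyclic) ∧
    ∀ i j, i ≠ j → Disjoint (F i).edgeSet (F j).edgeSet

/-- Total number of edges of a family of graphs. -/
noncomputable def size {t : ℕ} (F : Fin t → SimpleGraph V) : ℕ := ∑ i, (F i).edgeSet.ncard

/-- A single exchange step. -/
def Step (G : SimpleGraph V) {t : ℕ} (F F' : Fin t → SimpleGraph V) : Prop :=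
  ∃ i u v f, G.Adj u v ∧ (∀ j, s(u, v) ∉ (F j).edgeSet) ∧ f ∈ (F i).edgeSet ∧
    ¬ ((F i).deleteEdges {f}).Reachable u v ∧ F' = Function.update F i (swapG (F i) f u v)

lemma pack_update {G : SimpleGraph V} {t : ℕ} {F : Fin t → SimpleGraph V} (hF : Pack G F)
    (i : Fin t) (A : SimpleGraph V) (hA : A.IsAcyclic) {u v : V} (huv : G.Adj u v)
    (hun : ∀ j, s(u, v) ∉ (F j).edgeSet)
    (hsub : A.edgeSet ⊆ insert s(u, v) (F i).edgeSet) : Pack G (Function.update F i A) := by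
  have hd : ∀ j, j ≠ i → Disjoint A.edgeSet (F j).edgeSet := by
    intro j hj
    refine Disjoint.mono_left hsub ?_
    rw [Set.disjoint_insert_left]
    exact ⟨hun j, hF.2.2 i j hj.symm⟩
  refine ⟨?_, ?_, ?_⟩
  · intro j
    by_cases hj : j = i
    · subst hj
      rw [Function.update_self, ← SimpleGraph.edgeSet_subset_edgeSet]
      refine hsub.trans (Set.insert_subset huv ?_)
      exact SimpleGraph.edgeSet_mono (hF.1 j)
    · rw [Function.update_of_ne hj]; exact hF.1 j
  · intro j
    by_cases hj : j = i
    · subst hj; rwa [Function.update_self]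
    · rw [Function.update_of_ne hj]; exact hF.2.1 j
  · intro j k hjk
    by_cases hj : j = i
    · subst hj
      rw [Function.update_self, Function.update_of_ne hjk.symm]
      exact hd k hjk.symm
    · by_cases hk : k = i
      · subst hk
        rw [Function.update_self, Function.update_of_ne hjk]
        exact (hd j hjk).symm
      · rw [Function.update_of_ne hj, Function.update_of_ne hk]
        exact hF.2.2 j k hjk

lemma size_update {t : ℕ} (F : Fin t → SimpleGraph V) (i : Fin t) (A : SimpleGraph V) :
    size (Function.update F i A) + (F i).edgeSet.ncard = size F + A.edgeSet.ncard := by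
  unfold size
  rw [← Finset.add_sum_erase _ _ (Finset.mem_univ i),
    ← Finset.add_sum_erase _ (fun i => (F i).edgeSet.ncard) (Finset.mem_univ i)]
  have : ∑ x ∈ Finset.univ.erase i, (Function.update F i A x).edgeSet.ncard
      = ∑ x ∈ Finset.univ.erase i, (F x).edgeSet.ncard := by
    refine Finset.sum_congr rfl fun x hx => ?_
    rw [Function.update_of_ne (Finset.ne_of_mem_erase hx)]
  rw [this, Function.update_self]
  ring

lemma step_pack [Finite V] {G : SimpleGraph V} {t : ℕ} {F F' : Fin t → SimpleGraph V}
    (hF : Pack G F) (h : Step G F F') : Pack G F' ∧ size F' = size F := by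
  obtain ⟨i, u, v, f, huv, hun, hf, hr, rfl⟩ := h
  constructor
  · refine pack_update hF i _ (acyclic_swapG (hF.2.1 i) hr) huv hun ?_
    rw [edgeSet_swapG _ _ huv.ne]
    exact Set.insert_subset_insert Set.sdiff_subset
  · have := size_update F i (swapG (F i) f u v)
    rw [ncard_swapG huv.ne hf (hun i)] at this
    omega

lemma steps_pack [Finite V] {G : SimpleGraph V} {t : ℕ} {F F' : Fin t → SimpleGraph V}
    (hF : Pack G F) (h : Relation.ReflTransGen (Step G) F F') :
    Pack G F' ∧ size F' = size F := by
  induction h with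
  | refl => exact ⟨hF, rfl⟩
  | tail _ h2 ih =>
    have := step_pack ih.1 h2
    exact ⟨this.1, this.2.trans ih.2⟩

/-- Edges left uncovered by some family reachable from `F`. -/
def Sset (G : SimpleGraph V) {t : ℕ} (F : Fin t → SimpleGraph V) : Set (Sym2 V) :=
  {e | e ∈ G.edgeSet ∧ ∃ F', Relation.ReflTransGen (Step G) F F' ∧ ∀ j, e ∉ (F' j).edgeSet}

lemma key_reach [Finite V] {G : SimpleGraph V} {t : ℕ} {F F' : Fin t → SimpleGraph V}
    (hF : Pack G F) (hmax : ∀ F' : Fin t → SimpleGraph V, Pack G F' → size F' ≤ size F)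
    (h : Relation.ReflTransGen (Step G) F F') {u v : V} (huv : G.Adj u v)
    (hun : ∀ j, s(u, v) ∉ (F' j).edgeSet) (i : Fin t) :
    (F' i ⊓ SimpleGraph.fromEdgeSet (Sset G F)).Reachable u v := by
  obtain ⟨hP, hs⟩ := steps_pack hF h
  have h1 : (F' i).Reachable u v := by
    by_contra hr
    have hE : (F' i ⊔ SimpleGraph.edge u v).edgeSet = insert s(u, v) (F' i).edgeSet := by
      rw [SimpleGraph.edgeSet_sup, edgeSet_edge_ne huv.ne,
        Set.union_singleton]
    have hp := pack_update hP i _ ((hP.2.1 i).sup_edge_of_not_reachable hr) huv hun hE.le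
    have h2 := hmax _ hp
    have h3 := size_update F' i (F' i ⊔ SimpleGraph.edge u v)
    rw [hE, Set.ncard_insert_of_notMem (hun i)] at h3
    omega
  obtain ⟨p, hp⟩ := h1.exists_isPath
  refine ⟨p.transfer _ ?_⟩
  intro f hf
  have hfF := p.edges_subset_edgeSet hf
  have hne : f ≠ s(u, v) := fun h => hun i (h ▸ hfF)
  rw [SimpleGraph.edgeSet_inf, SimpleGraph.edgeSet_fromEdgeSet]
  have hfG : f ∈ G.edgeSet := SimpleGraph.edgeSet_mono (hP.1 i) hfF
  refine ⟨hfF, ⟨hfG, _, h.tail ⟨i, u, v, f, huv, hun, hfF,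
    not_reach_of_mem_path (hP.2.1 i) hp hf, rfl⟩, ?_⟩, ?_⟩
  · intro j
    by_cases hj : j = i
    · subst hj
      rw [Function.update_self, edgeSet_swapG _ _ huv.ne]
      simp [hne]
    · rw [Function.update_of_ne hj]
      exact fun hfj => Set.disjoint_left.1 (hP.2.2 j i hj) hfj hfF
  · exact fun hd => G.not_isDiag_of_mem_edgeSet hfG hd

lemma reach_back [Finite V] {G : SimpleGraph V} {t : ℕ} {F F' : Fin t → SimpleGraph V}
    (hF : Pack G F) (hmax : ∀ F' : Fin t → SimpleGraph V, Pack G F' → size F' ≤ size F)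
    (h : Relation.ReflTransGen (Step G) F F') (i : Fin t) {x y : V}
    (hxy : (F' i ⊓ SimpleGraph.fromEdgeSet (Sset G F)).Reachable x y) :
    (F i ⊓ SimpleGraph.fromEdgeSet (Sset G F)).Reachable x y := by
  induction h generalizing x y with
  | refl => exact hxy
  | @tail F1 F2 h1 h2 ih =>
    apply ih
    obtain ⟨k, u, v, f, huv, hun, hf, hr, rfl⟩ := h2
    by_cases hk : i = k
    · subst hk
      rw [Function.update_self] at hxy
      have hkey := key_reach hF hmax h1 huv hun i
      obtain ⟨w⟩ := hxy
      induction w with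
      | nil => exact .rfl
      | cons hadj _ ihw =>
        refine SimpleGraph.Reachable.trans ?_ ihw
        obtain ⟨ha, hb⟩ := hadj
        rcases ha with ha | ha
        · exact SimpleGraph.Adj.reachable ⟨SimpleGraph.deleteEdges_le _ ha, hb⟩
        · rw [SimpleGraph.edge_adj] at ha
          rcases ha.1 with ⟨rfl, rfl⟩ | ⟨rfl, rfl⟩
          · exact hkey
          · exact hkey.symm
    · rwa [Function.update_of_ne hk] at hxy

lemma mem_cross [Fintype V] (G : SimpleGraph V) (P : Finpartition (Finset.univ : Finset V))
    (u v : V) : s(u, v) ∈ edgesCrossing G P ↔ G.Adj u v ∧ P.part u ≠ P.part v := by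
  unfold edgesCrossing
  rw [Finset.mem_filter, SimpleGraph.mem_edgeFinset, SimpleGraph.mem_edgeSet]
  refine and_congr_right fun _ => not_congr ?_
  rw [← P.mem_part_iff_part_eq_part (Finset.mem_univ _) (Finset.mem_univ _),
    P.mem_part_iff_exists]
  simp [Sym2.mem_iff]

lemma parts_card [Fintype V] (P : Finpartition (Finset.univ : Finset V)) :
    (Finset.univ.image P.part).card = P.parts.card := by
  congr 1
  ext p
  simp only [Finset.mem_image, Finset.mem_univ, true_and]
  constructor
  · rintro ⟨a, rfl⟩
    simp
  · intro hp
    obtain ⟨a, -, h⟩ := P.part_surjOn hp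
    exact ⟨a, h⟩

/-- Tree packing theorem (Nash-Williams, Tutte). -/
theorem tree_packing [Fintype V] [Nonempty V] (G : SimpleGraph V) (t : ℕ)
    (hcr : ∀ P : Finpartition (Finset.univ : Finset V),
      t * (P.parts.card - 1) ≤ (edgesCrossing G P).card) :
    ∃ F : Fin t → SimpleGraph V, (∀ i, F i ≤ G) ∧ (∀ i, (F i).IsTree) ∧
      ∀ i j, i ≠ j → Disjoint (F i).edgeSet (F j).edgeSet := by
  obtain ⟨F, hF, hmax⟩ := Set.exists_max_image {F : Fin t → SimpleGraph V | Pack G F} size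
    (Set.toFinite _) ⟨fun _ => ⊥, fun _ => bot_le, fun _ => SimpleGraph.isAcyclic_bot, by simp⟩
  simp only [Set.mem_ofPred_eq] at hF hmax
  refine ⟨F, hF.1, ?_, hF.2.2⟩
  by_contra hnt
  push Not at hnt
  obtain ⟨i0, hi0⟩ := hnt
  set n := Fintype.card V with hn
  -- total size is small
  have hsize : size F + t < t * n := by
    have h1 : ∀ i, (F i).edgeSet.ncard + 1 ≤ n := fun i => (acyclic_card (hF.2.1 i)).1
    have h2 : (F i0).edgeSet.ncard + 1 < n :=
      lt_of_le_of_ne (h1 i0) (fun h => hi0 ((acyclic_card (hF.2.1 i0)).2 h))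
    have h3 : ∑ i, ((F i).edgeSet.ncard + 1) < ∑ _i : Fin t, n :=
      Finset.sum_lt_sum (fun i _ => h1 i) ⟨i0, Finset.mem_univ _, h2⟩
    simpa [Finset.sum_add_distrib, size] using h3
  set S := Sset G F with hS
  let H := SimpleGraph.fromEdgeSet S
  let P : Finpartition (Finset.univ : Finset V) := Finpartition.ofSetoid H.reachableSetoid
  have hP : ∀ u v, P.part u = P.part v → H.Reachable u v := by
    intro u v h
    rw [← P.mem_part_iff_part_eq_part (Finset.mem_univ _) (Finset.mem_univ _)] at h
    exact (Finpartition.mem_part_ofSetoid_iff_rel.1 h : H.Reachable v u).symm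
  have hP' : ∀ u v, H.Reachable u v → P.part u = P.part v := by
    intro u v h
    rw [← P.mem_part_iff_part_eq_part (Finset.mem_univ _) (Finset.mem_univ _)]
    exact Finpartition.mem_part_ofSetoid_iff_rel.2 h.symm
  have hreach : ∀ i u v, H.Reachable u v →
      (F i ⊓ SimpleGraph.fromEdgeSet (Sset G F)).Reachable u v := by
    rintro i u v ⟨w⟩
    induction w with
    | nil => exact .rfl
    | cons hadj _ ihw =>
      refine SimpleGraph.Reachable.trans ?_ ihw
      rw [SimpleGraph.fromEdgeSet_adj] at hadj
      obtain ⟨⟨hG, F', h1, h2⟩, -⟩ := hadj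
      exact reach_back hF hmax h1 i (key_reach hF hmax h1 hG h2 i)
  have hcount : ∀ i, n ≤ ((F i).edgeSet ∩ S).ncard + P.parts.card := by
    intro i
    have := card_le_edges_add (F i ⊓ SimpleGraph.fromEdgeSet (Sset G F)) P.part
      (fun u v h => hreach i u v (hP u v h))
    rw [parts_card] at this
    refine this.trans (Nat.add_le_add_right (Set.ncard_le_ncard ?_ (Set.toFinite _)) _)
    rw [SimpleGraph.edgeSet_inf, SimpleGraph.edgeSet_fromEdgeSet]
    exact Set.inter_subset_inter_right _ Set.sdiff_subset
  have hcross : (edgesCrossing G P).card ≤ ∑ i, ((F i).edgeSet \ S).ncard := by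
    have hsub : edgesCrossing G P ⊆
        Finset.univ.biUnion (fun i => ((F i).edgeSet \ S).toFinset) := by
      intro e he
      induction e using Sym2.ind with
      | _ u v =>
        rw [mem_cross] at he
        have hnS : s(u, v) ∉ S := by
          intro h
          refine he.2 (hP' u v (SimpleGraph.Adj.reachable ?_))
          rw [SimpleGraph.fromEdgeSet_adj]
          exact ⟨h, he.1.ne⟩
        have : ∃ i, s(u, v) ∈ (F i).edgeSet := by
          by_contra hno
          push Not at hno
          exact hnS ⟨he.1, F, .refl, hno⟩
        obtain ⟨i, hi⟩ := this
        simp only [Finset.mem_biUnion, Finset.mem_univ, true_and, Set.mem_toFinset]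
        exact ⟨i, hi, hnS⟩
    refine (Finset.card_le_card hsub).trans (Finset.card_biUnion_le.trans ?_)
    refine Finset.sum_le_sum fun i _ => ?_
    rw [Set.ncard_eq_toFinset_card']
  have hsum : size F = ∑ i, ((F i).edgeSet ∩ S).ncard + ∑ i, ((F i).edgeSet \ S).ncard := by
    rw [← Finset.sum_add_distrib]
    exact Finset.sum_congr rfl fun i _ =>
      (Set.ncard_inter_add_ncard_sdiff_eq_ncard _ _ (Set.toFinite _)).symm
  have hc2 : t * n ≤ ∑ i, ((F i).edgeSet ∩ S).ncard + t * P.parts.card := by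
    have := Finset.sum_le_sum (s := (Finset.univ : Finset (Fin t))) (fun i _ => hcount i)
    simpa [Finset.sum_add_distrib] using this
  have hmain := hcr P
  have hpos : 1 ≤ P.parts.card := by
    rw [← parts_card, Nat.one_le_iff_ne_zero, Finset.card_ne_zero]
    exact Finset.univ_nonempty.image _
  obtain ⟨k, hk⟩ := Nat.exists_eq_add_of_le hpos
  rw [hk] at hmain hc2
  have : 1 + k - 1 = k := by omega
  rw [this] at hmain
  rw [Nat.mul_add] at hc2
  omega

/-- Symmetric exchange between two edge-disjoint trees. -/
lemma tree_exchange [Fintype V] {A B : SimpleGraph V} (hA : A.IsTree) (hB : B.IsTree)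
    (hd : Disjoint A.edgeSet B.edgeSet) {a : Sym2 V} (ha : a ∈ A.edgeSet) :
    ∃ b ∈ B.edgeSet, ∃ A' B' : SimpleGraph V, A'.IsTree ∧ B'.IsTree ∧
      A'.edgeSet = insert b (A.edgeSet \ {a}) ∧ B'.edgeSet = insert a (B.edgeSet \ {b}) := by
  induction a using Sym2.ind with
  | _ u v =>
  have ha' : A.Adj u v := ha
  have huv : u ≠ v := ha'.ne
  have : Nonempty V := ⟨u⟩
  obtain ⟨p, hp⟩ := (hB.connected.preconnected u v).exists_isPath
  have hbr : ¬ (A.deleteEdges {s(u, v)}).Reachable u v :=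
    not_reach_of_mem_path hA.isAcyclic (p := SimpleGraph.Walk.cons ha' .nil)
      (by simp [huv]) (by simp)
  obtain ⟨d, hdp, h1, h2⟩ := p.exists_boundary_dart
    {x | (A.deleteEdges {s(u, v)}).Reachable u x} (SimpleGraph.Reachable.refl u) hbr
  have hbB : s(d.fst, d.snd) ∈ B.edgeSet := d.adj
  have hbA : s(d.fst, d.snd) ∉ A.edgeSet := fun h => Set.disjoint_left.1 hd h hbB
  have haB : s(u, v) ∉ B.edgeSet := fun h => Set.disjoint_left.1 hd ha h
  have hbp : s(d.fst, d.snd) ∈ p.edges := List.mem_map.2 ⟨d, hdp, rfl⟩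
  have hr1 : ¬ (A.deleteEdges {s(u, v)}).Reachable d.fst d.snd := fun h => h2 (h1.trans h)
  have hr2 := not_reach_of_mem_path hB.isAcyclic hp hbp
  have hne : d.fst ≠ d.snd := d.adj.ne
  refine ⟨_, hbB, swapG A s(u, v) d.fst d.snd, swapG B s(d.fst, d.snd) u v, ?_, ?_,
    edgeSet_swapG _ _ hne, edgeSet_swapG _ _ huv⟩
  · refine (acyclic_card (acyclic_swapG hA.isAcyclic hr1)).2 ?_
    rw [ncard_swapG hne ha hbA, tree_card hA]
  · refine (acyclic_card (acyclic_swapG hB.isAcyclic hr2)).2 ?_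
    rw [ncard_swapG huv hbB haB, tree_card hB]

/-- A family of pairwise edge-disjoint spanning trees in `G`. -/
def TPack (G : SimpleGraph V) {t : ℕ} (F : Fin t → SimpleGraph V) : Prop :=
  (∀ i, F i ≤ G) ∧ (∀ i, (F i).IsTree) ∧
    ∀ i j, i ≠ j → Disjoint (F i).edgeSet (F j).edgeSet

lemma rainbow_of_excess [Fintype V] (G : SimpleGraph V) (t : ℕ) (c : Sym2 V → ℕ)
    (hex : ∃ F : Fin t → SimpleGraph V, TPack G F)
    (hcol : G.edgeFinset.card + 1 ≤ (G.edgeFinset.image c).card + t) :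
    HasRainbowSpanningTrees G c t := by
  obtain ⟨F, hF, hmax⟩ := Set.exists_max_image {F : Fin t → SimpleGraph V | TPack G F}
    (fun F => ∑ i, (c '' (F i).edgeSet).ncard) (Set.toFinite _) hex
  simp only [Set.mem_ofPred_eq] at hF hmax
  refine ⟨F, hF.1, hF.2.1, ?_, hF.2.2⟩
  intro i
  by_contra hinj
  have : ∃ a ∈ (F i).edgeSet, ∃ a' ∈ (F i).edgeSet, c a = c a' ∧ a ≠ a' := by
    by_contra hno
    push Not at hno
    exact hinj fun a ha a' ha' h => hno a ha a' ha' h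
  obtain ⟨a, ha, a', ha', hcaa, haa⟩ := this
  -- if `e` lies in two trees they coincide
  have huniq : ∀ k l e, e ∈ (F k).edgeSet → e ∈ (F l).edgeSet → k = l := by
    intro k l e hk hl
    by_contra hne
    exact Set.disjoint_left.1 (hF.2.2 k l hne) hk hl
  have hj : ∃ j, j ≠ i ∧ Disjoint (c '' (F j).edgeSet) (c '' (F i).edgeSet) := by
    by_contra hno
    push Not at hno
    have hg : ∀ j, ∃ g ∈ (F j).edgeSet, (j = i → g = a) ∧
        ∃ e ∈ (F i).edgeSet, e ≠ a ∧ c e = c g := by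
      intro j
      by_cases hji : j = i
      · subst hji
        exact ⟨a, ha, fun _ => rfl, a', ha', haa.symm, hcaa.symm⟩
      · have := hno j hji
        rw [Set.not_disjoint_iff] at this
        obtain ⟨x, ⟨g, hg, rfl⟩, ⟨e, he, hce⟩⟩ := this
        by_cases hea : e = a
        · exact ⟨g, hg, fun h => absurd h hji, a', ha', haa.symm, by
            rw [← hcaa, ← hea, hce]⟩
        · exact ⟨g, hg, fun h => absurd h hji, e, he, hea, hce⟩
    choose g hgF hgi hge using hg
    have hginj : Function.Injective g := by
      intro k l hkl
      exact huniq k l (g k) (hgF k) (hkl ▸ hgF l)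
    let X := Finset.univ.image g
    have hX : X.card = t := by
      simp [X, Finset.card_image_of_injective _ hginj]
    have hXE : X ⊆ G.edgeFinset := by
      intro e he
      obtain ⟨k, -, rfl⟩ := Finset.mem_image.1 he
      rw [SimpleGraph.mem_edgeFinset]
      exact SimpleGraph.edgeSet_mono (hF.1 k) (hgF k)
    have himg : G.edgeFinset.image c ⊆ (G.edgeFinset \ X).image c := by
      intro x hx
      obtain ⟨e, he, rfl⟩ := Finset.mem_image.1 hx
      by_cases heX : e ∈ X
      · obtain ⟨k, -, rfl⟩ := Finset.mem_image.1 heX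
        obtain ⟨e', he', hne, hce⟩ := hge k
        rw [← hce]
        refine Finset.mem_image_of_mem _ (Finset.mem_sdiff.2 ⟨?_, ?_⟩)
        · rw [SimpleGraph.mem_edgeFinset]
          exact SimpleGraph.edgeSet_mono (hF.1 i) he'
        · intro h
          obtain ⟨l, -, rfl⟩ := Finset.mem_image.1 h
          exact hne (hgi l (huniq l i _ (hgF l) he'))
      · exact Finset.mem_image_of_mem _ (Finset.mem_sdiff.2 ⟨he, heX⟩)
    have h1 := (Finset.card_le_card himg).trans Finset.card_image_le
    have h2 := Finset.card_sdiff_add_card_eq_card hXE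
    omega
  obtain ⟨j, hji, hdisj⟩ := hj
  obtain ⟨b, hb, A', B', hA', hB', hAe, hBe⟩ :=
    tree_exchange (hF.2.1 i) (hF.2.1 j) (hF.2.2 i j hji.symm) ha
  let F' : Fin t → SimpleGraph V := fun k => if k = i then A' else if k = j then B' else F k
  have hF'i : F' i = A' := by simp [F']
  have hF'j : F' j = B' := by simp [F', hji]
  have hF'k : ∀ k, k ≠ i → k ≠ j → F' k = F k := by
    intro k h1 h2
    simp [F', h1, h2]
  have hmem : ∀ k e, e ∈ (F' k).edgeSet → ∃ l, e ∈ (F l).edgeSet ∧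
      ((e = a ∧ k = j) ∨ (e = b ∧ k = i) ∨ (e ≠ a ∧ e ≠ b ∧ k = l)) := by
    intro k e he
    by_cases hki : k = i
    · subst hki
      rw [hF'i, hAe] at he
      rcases he with rfl | ⟨he, hea⟩
      · exact ⟨j, hb, Or.inr (Or.inl ⟨rfl, rfl⟩)⟩
      · exact ⟨k, he, Or.inr (Or.inr ⟨hea, fun h => hji (huniq j k b hb (h ▸ he)), rfl⟩)⟩
    · by_cases hkj : k = j
      · subst hkj
        rw [hF'j, hBe] at he
        rcases he with rfl | ⟨he, heb⟩
        · exact ⟨i, ha, Or.inl ⟨rfl, rfl⟩⟩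
        · exact ⟨k, he, Or.inr (Or.inr ⟨fun h => hji (huniq k i a (h ▸ he) ha), heb, rfl⟩)⟩
      · rw [hF'k k hki hkj] at he
        exact ⟨k, he, Or.inr (Or.inr ⟨fun h => hki (huniq k i a (h ▸ he) ha),
          fun h => hkj (huniq k j b (h ▸ he) hb), rfl⟩)⟩
  have hab : a ≠ b := fun h => hji (huniq j i b hb (h ▸ ha))
  have hT : TPack G F' := by
    refine ⟨?_, ?_, ?_⟩
    · intro k
      rw [← SimpleGraph.edgeSet_subset_edgeSet]
      intro e he
      obtain ⟨l, hl, -⟩ := hmem k e he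
      exact SimpleGraph.edgeSet_mono (hF.1 l) hl
    · intro k
      by_cases hki : k = i
      · subst hki; rwa [hF'i]
      · by_cases hkj : k = j
        · subst hkj; rwa [hF'j]
        · rw [hF'k k hki hkj]; exact hF.2.1 k
    · intro k l hkl
      rw [Set.disjoint_left]
      intro e hek hel
      obtain ⟨k', h1, h1'⟩ := hmem k e hek
      obtain ⟨l', h2, h2'⟩ := hmem l e hel
      have := huniq k' l' e h1 h2
      grind
  have hle := hmax F' hT
  refine absurd hle (not_le.2 (Finset.sum_lt_sum ?_ ⟨i, Finset.mem_univ _, ?_⟩))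
  · intro k _
    by_cases hki : k = i
    · subst hki
      rw [hF'i, hAe]
      refine Set.ncard_le_ncard ?_ (Set.toFinite _)
      rintro x ⟨e, he, rfl⟩
      by_cases hea : e = a
      · exact ⟨a', Or.inr ⟨ha', haa.symm⟩, by rw [hea, hcaa]⟩
      · exact ⟨e, Or.inr ⟨he, hea⟩, rfl⟩
    · by_cases hkj : k = j
      · subst hkj
        rw [hF'j, hBe, Set.image_insert_eq, Set.ncard_insert_of_notMem ?_ (Set.toFinite _)]
        · refine le_trans (Set.ncard_le_ncard (t := insert (c b) (c '' ((F k).edgeSet \ {b})))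
            ?_ (Set.toFinite _)) (Set.ncard_insert_le _ _)
          rintro x ⟨e, he, rfl⟩
          by_cases heb : e = b
          · left; rw [heb]
          · right; exact ⟨e, ⟨he, heb⟩, rfl⟩
        · rintro ⟨e, he, hce⟩
          exact Set.disjoint_left.1 hdisj ⟨e, he.1, hce⟩ ⟨a, ha, rfl⟩
      · rw [hF'k k hki hkj]
  · rw [hF'i, hAe]
    have hsub : insert (c b) (c '' (F i).edgeSet) ⊆ c '' (insert b ((F i).edgeSet \ {a})) := by
      rw [Set.image_insert_eq]
      refine Set.insert_subset_insert ?_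
      rintro x ⟨e, he, rfl⟩
      by_cases hea : e = a
      · exact ⟨a', ⟨ha', haa.symm⟩, by rw [hea, hcaa]⟩
      · exact ⟨e, ⟨he, hea⟩, rfl⟩
    have h1 := Set.ncard_le_ncard hsub (Set.toFinite _)
    rw [Set.ncard_insert_of_notMem (fun h => Set.disjoint_left.1 hdisj ⟨b, hb, rfl⟩ h)
      (Set.toFinite _)] at h1
    omega

lemma le_maxNonCross3 [Fintype V] (G : SimpleGraph V) (t : ℕ)
    (P : Finpartition (Finset.univ : Finset V)) (hP : 3 ≤ P.parts.card) :
    (edgesNonCrossing G P).card + t * (P.parts.card - 2) ≤ maxNonCross3 G t := by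
  refine le_csSup ⟨G.edgeFinset.card + t * Fintype.card V, ?_⟩ ⟨P, hP, rfl⟩
  rintro m ⟨Q, -, rfl⟩
  refine Nat.add_le_add (Finset.card_filter_le _ _) (Nat.mul_le_mul_left _ ?_)
  have := Q.card_parts_le_card
  rw [Finset.card_univ] at this
  omega

lemma cross_add_nonCross [Fintype V] (G : SimpleGraph V)
    (P : Finpartition (Finset.univ : Finset V)) :
    (edgesNonCrossing G P).card + (edgesCrossing G P).card = G.edgeFinset.card := by
  unfold edgesNonCrossing edgesCrossing
  exact Finset.card_filter_add_card_filter_not _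

lemma cross_delete [Fintype V] (G : SimpleGraph V) (e : Sym2 V)
    (P : Finpartition (Finset.univ : Finset V)) :
    edgesCrossing (G.deleteEdges {e}) P = (edgesCrossing G P).erase e := by
  ext f
  unfold edgesCrossing
  simp only [Finset.mem_filter, Finset.mem_erase, SimpleGraph.mem_edgeFinset,
    SimpleGraph.edgeSet_deleteEdges, Set.mem_sdiff, Set.mem_singleton_iff]
  tauto

/-- Common refinement of two tight bipartitions. -/
lemma tight_meet [Fintype V] (G : SimpleGraph V) (t : ℕ) (ht : 0 < t)
    (hcr : ∀ P : Finpartition (Finset.univ : Finset V),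
      t * (P.parts.card - 1) ≤ (edgesCrossing G P).card)
    (P Q : Finpartition (Finset.univ : Finset V))
    (hP : (edgesCrossing G P).card = t) (hQ : (edgesCrossing G Q).card = t)
    {e f : Sym2 V} (heP : e ∈ edgesCrossing G P) (hfP : f ∉ edgesCrossing G P)
    (hfQ : f ∈ edgesCrossing G Q) :
    ∃ R : Finpartition (Finset.univ : Finset V), 3 ≤ R.parts.card ∧
      (edgesCrossing G R).card ≤ t * (R.parts.card - 1) := by
  let st : Setoid V := Setoid.ker (fun x => (P.part x, Q.part x))
  let R : Finpartition (Finset.univ : Finset V) := Finpartition.ofSetoid st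
  have hR : ∀ x y, R.part x = R.part y ↔ P.part x = P.part y ∧ Q.part x = Q.part y := by
    intro x y
    rw [← R.mem_part_iff_part_eq_part (Finset.mem_univ _) (Finset.mem_univ _),
      Finpartition.mem_part_ofSetoid_iff_rel, Setoid.ker_def, Prod.mk.injEq]
    constructor <;> (rintro ⟨h1, h2⟩; exact ⟨h1.symm, h2.symm⟩)
  have h3 : 3 ≤ R.parts.card := by
    induction e using Sym2.ind with
    | _ x y =>
    induction f using Sym2.ind with
    | _ u v =>
    rw [mem_cross] at heP hfQ hfP
    have huv : P.part u = P.part v := by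
      by_contra h
      exact hfP ⟨hfQ.1, h⟩
    obtain ⟨w, hw⟩ : ∃ w, P.part w ≠ P.part u := by
      by_contra hno
      push Not at hno
      exact heP.2 ((hno x).trans (hno y).symm)
    have hsub : ({R.part u, R.part v, R.part w} : Finset (Finset V)) ⊆ R.parts := by
      intro p hp
      simp only [Finset.mem_insert, Finset.mem_singleton] at hp
      rcases hp with rfl | rfl | rfl <;> simp
    have hc : ({R.part u, R.part v, R.part w} : Finset (Finset V)).card = 3 := by
      rw [Finset.card_eq_three]
      refine ⟨_, _, _, ?_, ?_, ?_, rfl⟩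
      · exact fun h => hfQ.2 ((hR _ _).1 h).2
      · exact fun h => hw ((hR _ _).1 h).1.symm
      · exact fun h => hw (((hR _ _).1 h).1.symm.trans huv.symm)
    rw [← hc]
    exact Finset.card_le_card hsub
  have hsub : edgesCrossing G R ⊆ edgesCrossing G P ∪ edgesCrossing G Q := by
    intro g hg
    induction g using Sym2.ind with
    | _ x y =>
    rw [Finset.mem_union, mem_cross, mem_cross]
    rw [mem_cross, Ne, hR] at hg
    tauto
  have h4 := (Finset.card_le_card hsub).trans (Finset.card_union_le _ _)
  refine ⟨R, h3, ?_⟩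
  calc (edgesCrossing G R).card ≤ t * 2 := by omega
    _ ≤ _ := Nat.mul_le_mul_left _ (by omega)

end RST

/-- If every partition `P` of `V(G)` satisfies
`|cr(P,G)| ≥ t(|P|-1)`, and `G` is edge-colored with exactly
`max_{P : |P| ≥ 3}{|E(P,G)| + t(|P|-2)} + 1` colors with no `t` pairwise
edge-disjoint rainbow spanning trees, then there is an edge `e` of `G` whose
color appears on at least two edges of `G` such that every partition `P`
satisfies `|cr(P, G \ e)| ≥ t(|P|-1)`. -/
theorem stmt13 {V : Type} [Fintype V] (G : SimpleGraph V) (t : ℕ) (ht : 0 < t)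
    (hV : 3 ≤ Fintype.card V)
    (hcr : ∀ P : Finpartition (Finset.univ : Finset V),
      t * (P.parts.card - 1) ≤ (edgesCrossing G P).card)
    (c : Sym2 V → ℕ)
    (hc : (G.edgeFinset.image c).card = maxNonCross3 G t + 1)
    (hno : ¬ HasRainbowSpanningTrees G c t) :
    ∃ e ∈ G.edgeSet, (∃ f ∈ G.edgeSet, f ≠ e ∧ c f = c e) ∧
      ∀ P : Finpartition (Finset.univ : Finset V),
        t * (P.parts.card - 1) ≤ (edgesCrossing (G.deleteEdges {e}) P).card := by
  classical
  by_contra hcon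
  push Not at hcon
  have hpos : 0 < Fintype.card V := by omega
  have : Nonempty V := Fintype.card_pos_iff.1 hpos
  -- it suffices to bound the excess of the colouring
  have hfin : ¬ (G.edgeFinset.card + 1 ≤ (G.edgeFinset.image c).card + t) := by
    intro h
    obtain ⟨F, hF⟩ := RST.tree_packing G t hcr
    exact hno (RST.rainbow_of_excess G t c ⟨F, hF⟩ h)
  -- there is no tight partition with at least three parts
  have h3 : ∀ P : Finpartition (Finset.univ : Finset V), 3 ≤ P.parts.card →
      ¬ (edgesCrossing G P).card ≤ t * (P.parts.card - 1) := by
    intro P hP htight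
    apply hfin
    have h1 := RST.le_maxNonCross3 G t P hP
    have h2 := RST.cross_add_nonCross G P
    obtain ⟨k, hk⟩ := Nat.exists_eq_add_of_le hP
    have e1 : P.parts.card - 1 = k + 2 := by omega
    have e2 : P.parts.card - 2 = k + 1 := by omega
    rw [e1] at htight
    rw [e2] at h1
    have e3 : t * (k + 2) = t * (k + 1) + t := by ring
    rw [hc]
    omega
  -- every edge of a repeated colour crosses a tight partition with two parts
  have hT : ∀ e ∈ G.edgeSet, (∃ f ∈ G.edgeSet, f ≠ e ∧ c f = c e) →
      ∃ P : Finpartition (Finset.univ : Finset V),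
        e ∈ edgesCrossing G P ∧ (edgesCrossing G P).card = t := by
    intro e he hrep
    obtain ⟨P, hP⟩ := hcon e he hrep
    rw [RST.cross_delete] at hP
    have hcP := hcr P
    by_cases heP : e ∈ edgesCrossing G P
    · refine ⟨P, heP, ?_⟩
      have h1 := Finset.card_erase_add_one heP
      have h2 : ¬ 3 ≤ P.parts.card := fun h => h3 P h (by omega)
      have h4 : P.parts.card = 2 := by
        by_contra hne
        have : P.parts.card - 1 = 0 := by omega
        rw [this] at hP
        omega
      rw [h4] at hP hcP
      omega
    · rw [Finset.erase_eq_of_notMem heP] at hP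
      omega
  by_cases hrep : ∃ e ∈ G.edgeSet, ∃ f ∈ G.edgeSet, f ≠ e ∧ c f = c e
  · obtain ⟨e, he, hef⟩ := hrep
    obtain ⟨P, heP, hPt⟩ := hT e he hef
    by_cases hall : ∀ g ∈ G.edgeSet, (∃ f ∈ G.edgeSet, f ≠ g ∧ c f = c g) →
        g ∈ edgesCrossing G P
    · apply hfin
      have hsub : edgesCrossing G P ⊆ G.edgeFinset := Finset.filter_subset _ _
      have h1 := Finset.card_sdiff_add_card_eq_card hsub
      have hinj : Set.InjOn c (G.edgeFinset \ edgesCrossing G P : Finset (Sym2 V)) := by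
        intro x hx y hy hxy
        by_contra hne
        rw [Finset.mem_coe, Finset.mem_sdiff, SimpleGraph.mem_edgeFinset] at hx hy
        exact hx.2 (hall x hx.1 ⟨y, hy.1, Ne.symm hne, hxy.symm⟩)
      have h2 := Finset.card_image_of_injOn hinj
      have hnot : c e ∉ (G.edgeFinset \ edgesCrossing G P).image c := by
        intro h
        obtain ⟨x, hx, hxe⟩ := Finset.mem_image.1 h
        rw [Finset.mem_sdiff, SimpleGraph.mem_edgeFinset] at hx
        have hne : e ≠ x := fun h => hx.2 (h ▸ heP)
        exact hx.2 (hall x hx.1 ⟨e, he, hne, hxe.symm⟩)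
      have h4 := Finset.card_insert_of_notMem hnot
      have h5 : insert (c e) ((G.edgeFinset \ edgesCrossing G P).image c) ⊆
          G.edgeFinset.image c := by
        refine Finset.insert_subset ?_ (Finset.image_subset_image Finset.sdiff_subset)
        exact Finset.mem_image_of_mem _ (SimpleGraph.mem_edgeFinset.2 he)
      have h6 := Finset.card_le_card h5
      omega
    · push Not at hall
      obtain ⟨g, hg, hgrep, hgP⟩ := hall
      obtain ⟨Q, hgQ, hQt⟩ := hT g hg hgrep
      obtain ⟨R, hR3, hR⟩ := RST.tight_meet G t ht hcr P Q hPt hQt heP hgP hgQ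
      exact h3 R hR3 hR
  · apply hfin
    have hinj : Set.InjOn c (G.edgeFinset : Set (Sym2 V)) := by
      intro x hx y hy hxy
      by_contra hne
      rw [SimpleGraph.coe_edgeFinset] at hx hy
      exact hrep ⟨x, hx, y, hy, Ne.symm hne, hxy.symm⟩
    rw [Finset.card_image_of_injOn hinj]
    omega
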